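/- Let α > 0, and for k ∈ ℤ let γ_k ∈ (-π/2, π/2) be the unique solution of tan(γ) = -2γα + απ/2 + 2παk + 1 and b_k := -2γ_k + π/2 + 2πk. Then lim_{k→+∞} γ_k = π/2 and lim_{k→-∞} γ_k = -π/2. -/

import Mathlib

open Real Filter

theorem gamma_limits (α : ℝ) (hα : 0 < α) (γ b : ℤ → ℝ)
    (hγ : ∀ k : ℤ, γ k ∈ Set.Ioo (-(π/2)) (π/2) ∧
      Real.tan (γ k) = -2*(γ k)*α + α*π/2 + 2*π*α*k + 1)
    (hb : ∀ k : ℤ, b k = -2*(γ k) + π/2 + 2*π*k) :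
    Tendsto γ atTop (nhds (π/2)) ∧ Tendsto γ atBot (nhds (-(π/2))) := by
  have hpos : 0 < 2 * π * α := by positivity
  have harc : γ = fun k => Real.arctan (Real.tan (γ k)) := by
    funext k
    exact (Real.arctan_tan (hγ k).1.1 (hγ k).1.2).symm
  have h1 : Tendsto (fun k : ℤ => Real.tan (γ k)) atTop atTop := by
    have h : Tendsto (fun k : ℤ => 2 * π * α * (k : ℝ) + (-(π * α) + α * π / 2 + 1)) atTop atTop :=
      tendsto_atTop_add_const_right _ _
        ((tendsto_intCast_atTop_atTop (R := ℝ)).const_mul_atTop hpos)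
    refine tendsto_atTop_mono (fun k => ?_) h
    have := mul_lt_mul_of_pos_right (hγ k).1.2 hα
    rw [(hγ k).2]
    linarith
  have h2 : Tendsto (fun k : ℤ => Real.tan (γ k)) atBot atBot := by
    have h : Tendsto (fun k : ℤ => 2 * π * α * (k : ℝ) + (π * α + α * π / 2 + 1)) atBot atBot :=
      tendsto_atBot_add_const_right _ _
        ((tendsto_intCast_atBot_iff (R := ℝ) (f := fun k : ℤ => k)).2 tendsto_id
          |>.const_mul_atBot hpos)
    refine tendsto_atBot_mono (fun k => ?_) h
    have := mul_lt_mul_of_pos_right (hγ k).1.1 hα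
    rw [(hγ k).2]
    linarith
  constructor
  · rw [harc]
    exact (tendsto_nhds_of_tendsto_nhdsWithin Real.tendsto_arctan_atTop).comp h1
  · rw [harc]
    exact (tendsto_nhds_of_tendsto_nhdsWithin Real.tendsto_arctan_atBot).comp h2
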